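/- There exist τ ≥ 0 and thresholds 0 ≤ smin ≤ smax ≤ 1 with smax = 1/(1+τ) and smin·(A* + B*) = B*, where A* = ∫_{[0,1]^(n−1)} w⁺(y)·1{∏_{k=1}^{n−1} y_k ≥ τ·∏(1−y_k)} dy and B* = ∫_{[0,1]^(n−1)} w⁻(y)·1{∏_{k=1}^{n−1} y_k ≥ τ·∏(1−y_k)} dy, such that the mechanism x* defined by x*(s,y) = 0 if s < smin, x*(s,y) = 1{∏_{k=1}^{n−1} y_k ≥ τ·∏(1−y_k)} if smin ≤ s < smax, and x*(s,y) = 1{s·∏_{k=1}^{n−1} y_k ≥ (1−s)·∏(1−y_k)} if s ≥ smax, is feasible and optimal: V(x) ≤ V(x*) for every feasible mechanism x. -/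

import Mathlib

open MeasureTheory Set Filter

noncomputable section

/-- The unit cube `[0,1]^m` inside `Fin m → ℝ`. -/
def cube (m : ℕ) : Set (Fin m → ℝ) := Set.univ.pi fun _ => Set.Icc (0:ℝ) 1

/-- `w⁺(y) = ∏ y_k · f(y_k)`. -/
def wplus (f : ℝ → ℝ) {m : ℕ} (y : Fin m → ℝ) : ℝ := ∏ k, y k * f (y k)

/-- `w⁻(y) = ∏ (1 - y_k) · f(y_k)`. -/
def wminus (f : ℝ → ℝ) {m : ℕ} (y : Fin m → ℝ) : ℝ := ∏ k, (1 - y k) * f (y k)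

/-- Hypotheses on the signal density `f` with derivative `f'` on `[L,R]`. -/
structure Density (f f' : ℝ → ℝ) (L R : ℝ) : Prop where
  nonneg : ∀ s, 0 ≤ f s
  zero_outside : ∀ s ∉ Set.Icc L R, f s = 0
  pos : ∀ s ∈ Set.Icc L R, 0 < f s
  hderiv : ∀ s ∈ Set.Icc L R, HasDerivWithinAt f (f' s) (Set.Icc L R) s
  cont_deriv : ContinuousOn f' (Set.Icc L R)
  total : (∫ s in L..R, f s) = 1
  mean : (∫ s in L..R, s * f s) = 1 / 2

/-- A mechanism is measurable with values in `[0,1]`. -/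
def IsMechanism {m : ℕ} (x : ℝ → (Fin m → ℝ) → ℝ) : Prop :=
  Measurable (Function.uncurry x) ∧ ∀ s y, x s y ∈ Set.Icc (0:ℝ) 1

/-- `A(t) = ∫_{[0,1]^m} x(t,y) w⁺(y) dy`. -/
def Amap (f : ℝ → ℝ) {m : ℕ} (x : ℝ → (Fin m → ℝ) → ℝ) (t : ℝ) : ℝ :=
  ∫ y in cube m, x t y * wplus f y

/-- `B(t) = ∫_{[0,1]^m} x(t,y) w⁻(y) dy`. -/
def Bmap (f : ℝ → ℝ) {m : ℕ} (x : ℝ → (Fin m → ℝ) → ℝ) (t : ℝ) : ℝ :=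
  ∫ y in cube m, x t y * wminus f y

/-- Interim payoff `U_x(t;s) = 2^m (s A(t) - (1-s) B(t))` (with `m = n-1`). -/
def Upay (f : ℝ → ℝ) {m : ℕ} (x : ℝ → (Fin m → ℝ) → ℝ) (t s : ℝ) : ℝ :=
  2 ^ m * (s * Amap f x t - (1 - s) * Bmap f x t)

/-- Feasibility: mechanism + participation + incentive compatibility on `[L,R]`. -/
def Feasible (f : ℝ → ℝ) (L R : ℝ) {m : ℕ} (x : ℝ → (Fin m → ℝ) → ℝ) : Prop :=
  IsMechanism x ∧ (∀ s ∈ Set.Icc L R, 0 ≤ Upay f x s s) ∧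
    (∀ s ∈ Set.Icc L R, ∀ t ∈ Set.Icc L R, Upay f x t s ≤ Upay f x s s)

/-- The designer's value `V(x)`. -/
def Value (f : ℝ → ℝ) (L R : ℝ) {m : ℕ} (x : ℝ → (Fin m → ℝ) → ℝ) : ℝ :=
  2 ^ m * ∫ s in L..R, (s * Amap f x s + (1 - s) * Bmap f x s) * f s

/-- The first-best utility `Ubar`. -/
def Ubar (f : ℝ → ℝ) (m : ℕ) (s : ℝ) : ℝ :=
  2 ^ m * ∫ y in cube m, max (s * wplus f y - (1 - s) * wminus f y) 0

/-! ### Null level sets -/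

lemma ae_prod_ne_zero (m : ℕ) : ∀ᵐ y : Fin m → ℝ, (∏ k, y k) ≠ 0 := by
  have h : ∀ k : Fin m, ∀ᵐ y : Fin m → ℝ, y k ≠ 0 := by
    intro k
    have := Measure.pi_hyperplane (fun _ : Fin m => (volume : Measure ℝ)) k (0:ℝ)
    rw [ae_iff]
    simpa [volume_pi] using this
  filter_upwards [ae_all_iff.2 h] with y hy
  exact Finset.prod_ne_zero_iff.2 (fun k _ => hy k)

lemma ae_level_ne (m : ℕ) (hm : 1 ≤ m) (τ : ℝ) :
    ∀ᵐ y : Fin m → ℝ, τ * ∏ k, (1 - y k) ≠ ∏ k, y k := by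
  obtain ⟨k, rfl⟩ : ∃ k, m = k + 1 := ⟨m - 1, by omega⟩
  have mp := volume_preserving_piFinSuccAbove (fun _ : Fin (k+1) => ℝ) 0
  have key : ∀ᵐ p : ℝ × (Fin k → ℝ),
      τ * ((1 - p.1) * ∏ i, (1 - p.2 i)) ≠ p.1 * ∏ i, p.2 i := by
    rw [ae_iff]
    have hms : MeasurableSet {p : (Fin k → ℝ) × ℝ |
        ¬ (τ * ((1 - p.2) * ∏ i, (1 - p.1 i)) ≠ p.2 * ∏ i, p.1 i)} := by
      simp only [ne_eq, not_not]
      apply measurableSet_eq_fun <;> fun_prop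
    have h0 : (volume : Measure ((Fin k → ℝ) × ℝ)) {p : (Fin k → ℝ) × ℝ |
        ¬ (τ * ((1 - p.2) * ∏ i, (1 - p.1 i)) ≠ p.2 * ∏ i, p.1 i)} = 0 := by
      rw [Measure.volume_eq_prod, Measure.measure_prod_null hms]
      filter_upwards [ae_prod_ne_zero k] with z hz
      simp only [ne_eq, not_not, preimage_ofPred_eq, Pi.zero_apply]
      apply Set.Subsingleton.measure_zero
      intro a ha b hb
      simp only [mem_ofPred_eq] at ha hb
      have h1 : (a - b) * ((∏ i, z i) + τ * ∏ i, (1 - z i)) = 0 := by linarith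
      rcases mul_eq_zero.1 h1 with h | h
      · linarith
      · exfalso
        apply hz
        linear_combination ha * (-1) + (1 - a) * h
    have hsw := (Measure.measurePreserving_swap (μ := (volume : Measure ℝ))
      (ν := (volume : Measure (Fin k → ℝ))))
    have := hsw.measure_preimage hms.nullMeasurableSet
    rw [← Measure.volume_eq_prod, ← Measure.volume_eq_prod, h0] at this
    exact this
  have := mp.quasiMeasurePreserving.ae key
  filter_upwards [this] with y hy
  simpa [Fin.prod_univ_succ, MeasurableEquiv.piFinSuccAbove, Fin.tail] using hy

/-! ### Density basics -/

lemma dens_meas {f f' : ℝ → ℝ} {L R : ℝ} (hf : Density f f' L R) : Measurable f := by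
  classical
  have hc : ContinuousOn f (Icc L R) := fun s hs => (hf.hderiv s hs).continuousWithinAt
  have h := ContinuousOn.measurable_piecewise (g := fun _ : ℝ => (0:ℝ)) hc
    continuousOn_const measurableSet_Icc
  convert h using 1
  ext s
  by_cases hs : s ∈ Icc L R
  · simp [hs]
  · rw [Set.piecewise_eq_of_notMem _ _ _ hs, hf.zero_outside s hs]

lemma dens_bdd {f f' : ℝ → ℝ} {L R : ℝ} (hf : Density f f' L R) :
    ∃ C, 0 ≤ C ∧ ∀ s, f s ≤ C := by
  have hc : ContinuousOn f (Icc L R) := fun s hs => (hf.hderiv s hs).continuousWithinAt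
  obtain ⟨C, hC⟩ := isCompact_Icc.exists_bound_of_continuousOn hc
  refine ⟨max C 0, le_max_right _ _, fun s => ?_⟩
  by_cases hs : s ∈ Icc L R
  · exact (le_abs_self _).trans ((hC s hs).trans (le_max_left _ _))
  · rw [hf.zero_outside s hs]; exact le_max_right _ _

lemma cube_meas (m : ℕ) : MeasurableSet (cube m) :=
  MeasurableSet.univ_pi fun _ => measurableSet_Icc

lemma cube_fin (m : ℕ) : volume (cube m) < ⊤ := by
  unfold cube
  exact (isCompact_univ_pi fun _ => isCompact_Icc).measure_lt_top

instance cube_finite (m : ℕ) : IsFiniteMeasure (volume.restrict (cube m)) :=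
  ⟨by simpa using cube_fin m⟩

/-- Product density. -/
def Fd (f : ℝ → ℝ) {m : ℕ} (y : Fin m → ℝ) : ℝ := ∏ k, f (y k)

lemma wplus_eq (f : ℝ → ℝ) {m : ℕ} (y : Fin m → ℝ) :
    wplus f y = (∏ k, y k) * Fd f y := by
  simp [wplus, Fd, Finset.prod_mul_distrib]

lemma wminus_eq (f : ℝ → ℝ) {m : ℕ} (y : Fin m → ℝ) :
    wminus f y = (∏ k, (1 - y k)) * Fd f y := by
  simp [wminus, Fd, Finset.prod_mul_distrib]

lemma P_mem {m : ℕ} {y : Fin m → ℝ} (hy : y ∈ cube m) : ∏ k, y k ∈ Icc (0:ℝ) 1 := by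
  have h : ∀ k, y k ∈ Icc (0:ℝ) 1 := fun k => hy k (mem_univ k)
  exact ⟨Finset.prod_nonneg fun k _ => (h k).1,
    Finset.prod_le_one (fun k _ => (h k).1) fun k _ => (h k).2⟩

lemma Q_mem {m : ℕ} {y : Fin m → ℝ} (hy : y ∈ cube m) : ∏ k, (1 - y k) ∈ Icc (0:ℝ) 1 := by
  have h : ∀ k, y k ∈ Icc (0:ℝ) 1 := fun k => hy k (mem_univ k)
  exact ⟨Finset.prod_nonneg fun k _ => by linarith [(h k).2],
    Finset.prod_le_one (fun k _ => by linarith [(h k).2]) fun k _ => by linarith [(h k).1]⟩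

section
variable {f f' : ℝ → ℝ} {L R : ℝ} {m : ℕ}

lemma Fd_nonneg (hf : Density f f' L R) (y : Fin m → ℝ) : 0 ≤ Fd f y :=
  Finset.prod_nonneg fun k _ => hf.nonneg _

lemma Fd_meas (hf : Density f f' L R) : Measurable (fun y : Fin m → ℝ => Fd f y) := by
  have := dens_meas hf
  unfold Fd
  fun_prop

lemma wplus_meas (hf : Density f f' L R) : Measurable (fun y : Fin m → ℝ => wplus f y) := by
  have := Fd_meas (m := m) hf
  simp only [wplus_eq]
  fun_prop

lemma wminus_meas (hf : Density f f' L R) : Measurable (fun y : Fin m → ℝ => wminus f y) := by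
  have := Fd_meas (m := m) hf
  simp only [wminus_eq]
  fun_prop

lemma wplus_nonneg (hf : Density f f' L R) {y : Fin m → ℝ} (hy : y ∈ cube m) :
    0 ≤ wplus f y := by
  rw [wplus_eq]; exact mul_nonneg (P_mem hy).1 (Fd_nonneg hf y)

lemma wminus_nonneg (hf : Density f f' L R) {y : Fin m → ℝ} (hy : y ∈ cube m) :
    0 ≤ wminus f y := by
  rw [wminus_eq]; exact mul_nonneg (Q_mem hy).1 (Fd_nonneg hf y)

lemma w_bdd (m : ℕ) (hf : Density f f' L R) : ∃ C, 0 ≤ C ∧ ∀ y ∈ cube m,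
    wplus f y ≤ C ∧ wminus f y ≤ C := by
  obtain ⟨C, hC0, hC⟩ := dens_bdd hf
  refine ⟨C ^ m, by positivity, fun y hy => ?_⟩
  have h1 : Fd f y ≤ C ^ m := by
    unfold Fd
    calc ∏ k, f (y k) ≤ ∏ _ : Fin m, C :=
          Finset.prod_le_prod (fun k _ => hf.nonneg _) (fun k _ => hC _)
      _ = C ^ m := by simp
  have h0 := Fd_nonneg hf y
  rw [wplus_eq, wminus_eq]
  constructor
  · nlinarith [(P_mem hy).2, (P_mem hy).1]
  · nlinarith [(Q_mem hy).2, (Q_mem hy).1]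

lemma int_wplus (hf : Density f f' L R) {z : (Fin m → ℝ) → ℝ} (hz : Measurable z)
    (hz1 : ∀ y, z y ∈ Icc (0:ℝ) 1) :
    Integrable (fun y => z y * wplus f y) (volume.restrict (cube m)) := by
  obtain ⟨C, hC0, hC⟩ := w_bdd m hf
  refine Integrable.mono' (integrable_const C)
    (hz.mul (wplus_meas hf)).aestronglyMeasurable ?_
  filter_upwards [ae_restrict_mem (cube_meas m)] with y hy
  have h0 := wplus_nonneg hf hy
  rw [Real.norm_of_nonneg (mul_nonneg (hz1 y).1 h0)]
  nlinarith [(hC y hy).1, (hz1 y).1, (hz1 y).2]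

lemma int_wminus (hf : Density f f' L R) {z : (Fin m → ℝ) → ℝ} (hz : Measurable z)
    (hz1 : ∀ y, z y ∈ Icc (0:ℝ) 1) :
    Integrable (fun y => z y * wminus f y) (volume.restrict (cube m)) := by
  obtain ⟨C, hC0, hC⟩ := w_bdd m hf
  refine Integrable.mono' (integrable_const C)
    (hz.mul (wminus_meas hf)).aestronglyMeasurable ?_
  filter_upwards [ae_restrict_mem (cube_meas m)] with y hy
  have h0 := wminus_nonneg hf hy
  rw [Real.norm_of_nonneg (mul_nonneg (hz1 y).1 h0)]
  nlinarith [(hC y hy).2, (hz1 y).1, (hz1 y).2]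

lemma cmpU (hf : Density f f' L R) {z z' : (Fin m → ℝ) → ℝ} (hz : Measurable z)
    (hz1 : ∀ y, z y ∈ Icc (0:ℝ) 1) (hz' : Measurable z')
    (hz1' : ∀ y, z' y ∈ Icc (0:ℝ) 1) (s : ℝ)
    (h : ∀ y ∈ cube m, z y * (s * ∏ k, y k - (1 - s) * ∏ k, (1 - y k)) ≤
      z' y * (s * ∏ k, y k - (1 - s) * ∏ k, (1 - y k))) :
    s * (∫ y in cube m, z y * wplus f y) - (1 - s) * (∫ y in cube m, z y * wminus f y) ≤
    s * (∫ y in cube m, z' y * wplus f y) - (1 - s) * (∫ y in cube m, z' y * wminus f y) := by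
  rw [← integral_const_mul, ← integral_const_mul, ← integral_const_mul, ← integral_const_mul,
    ← integral_sub ((int_wplus hf hz hz1).const_mul _) ((int_wminus hf hz hz1).const_mul _),
    ← integral_sub ((int_wplus hf hz' hz1').const_mul _) ((int_wminus hf hz' hz1').const_mul _)]
  refine setIntegral_mono_on
    (((int_wplus hf hz hz1).const_mul _).sub ((int_wminus hf hz hz1).const_mul _))
    (((int_wplus hf hz' hz1').const_mul _).sub ((int_wminus hf hz' hz1').const_mul _))
    (cube_meas m) ?_
  intro y hy
  have := mul_le_mul_of_nonneg_right (h y hy) (Fd_nonneg hf y)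
  rw [wplus_eq, wminus_eq]
  linarith

/-- Threshold indicator. -/
def ind (σ : ℝ) (y : Fin m → ℝ) : ℝ := if σ * ∏ k, (1 - y k) ≤ ∏ k, y k then 1 else 0

lemma ind_meas (σ : ℝ) : Measurable (ind σ : (Fin m → ℝ) → ℝ) := by
  unfold ind
  apply Measurable.ite _ measurable_const measurable_const
  apply measurableSet_le <;> fun_prop

lemma ind_mem (σ : ℝ) (y : Fin m → ℝ) : ind σ y ∈ Icc (0:ℝ) 1 := by
  unfold ind; split_ifs <;> simp

def Ac (f : ℝ → ℝ) (m : ℕ) (σ : ℝ) : ℝ := ∫ y in cube m, ind σ y * wplus f y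
def Bc (f : ℝ → ℝ) (m : ℕ) (σ : ℝ) : ℝ := ∫ y in cube m, ind σ y * wminus f y

lemma Ac_nonneg (hf : Density f f' L R) (σ : ℝ) : 0 ≤ Ac f m σ :=
  setIntegral_nonneg (cube_meas m) fun y hy =>
    mul_nonneg (ind_mem σ y).1 (wplus_nonneg hf hy)

lemma Bc_nonneg (hf : Density f f' L R) (σ : ℝ) : 0 ≤ Bc f m σ :=
  setIntegral_nonneg (cube_meas m) fun y hy =>
    mul_nonneg (ind_mem σ y).1 (wminus_nonneg hf hy)

lemma ind_cont {y : Fin m → ℝ} {σ : ℝ} (h : σ * ∏ k, (1 - y k) ≠ ∏ k, y k) :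
    ContinuousAt (fun σ => ind σ y) σ := by
  have hc : Continuous (fun σ : ℝ => σ * ∏ k, (1 - y k)) := by fun_prop
  rcases lt_or_gt_of_ne h with h | h
  · have : (fun σ => ind σ y) =ᶠ[nhds σ] fun _ => 1 := by
      filter_upwards [hc.continuousAt.eventually_lt continuousAt_const h] with t ht
      simp [ind, ht.le]
    exact (continuousAt_const).congr this.symm
  · have : (fun σ => ind σ y) =ᶠ[nhds σ] fun _ => 0 := by
      filter_upwards [continuousAt_const.eventually_lt hc.continuousAt h] with t ht
      simp [ind, ht]
    exact (continuousAt_const).congr this.symm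

lemma Ac_cont (hf : Density f f' L R) (hm : 1 ≤ m) : Continuous (Ac f m) := by
  obtain ⟨C, hC0, hC⟩ := w_bdd m hf
  rw [continuous_iff_continuousAt]
  intro σ
  unfold Ac
  refine continuousAt_of_dominated (bound := fun _ => C) ?_ ?_ (integrable_const C) ?_
  · exact Eventually.of_forall fun t => ((ind_meas t).mul (wplus_meas hf)).aestronglyMeasurable
  · refine Eventually.of_forall fun t => ?_
    filter_upwards [ae_restrict_mem (cube_meas m)] with y hy
    have h0 := wplus_nonneg hf hy
    rw [Real.norm_of_nonneg (mul_nonneg (ind_mem t y).1 h0)]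
    nlinarith [(hC y hy).1, (ind_mem t y).1, (ind_mem t y).2]
  · filter_upwards [ae_restrict_of_ae (ae_level_ne m hm σ)] with y hy
    exact (ind_cont hy).mul continuousAt_const

lemma Bc_cont (hf : Density f f' L R) (hm : 1 ≤ m) : Continuous (Bc f m) := by
  obtain ⟨C, hC0, hC⟩ := w_bdd m hf
  rw [continuous_iff_continuousAt]
  intro σ
  unfold Bc
  refine continuousAt_of_dominated (bound := fun _ => C) ?_ ?_ (integrable_const C) ?_
  · exact Eventually.of_forall fun t => ((ind_meas t).mul (wminus_meas hf)).aestronglyMeasurable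
  · refine Eventually.of_forall fun t => ?_
    filter_upwards [ae_restrict_mem (cube_meas m)] with y hy
    have h0 := wminus_nonneg hf hy
    rw [Real.norm_of_nonneg (mul_nonneg (ind_mem t y).1 h0)]
    nlinarith [(hC y hy).2, (ind_mem t y).1, (ind_mem t y).2]
  · filter_upwards [ae_restrict_of_ae (ae_level_ne m hm σ)] with y hy
    exact (ind_cont hy).mul continuousAt_const

lemma Ac_bdd (hf : Density f f' L R) (m : ℕ) : ∃ C, 0 ≤ C ∧ ∀ σ, Ac f m σ ≤ C ∧ Bc f m σ ≤ C := by
  have h1 : ∀ y : Fin m → ℝ, (fun _ => (1:ℝ)) y ∈ Icc (0:ℝ) 1 := fun y => by simp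
  have hp := int_wplus (m := m) hf measurable_const h1
  have hq := int_wminus (m := m) hf measurable_const h1
  have hA : ∀ σ, Ac f m σ ≤ ∫ y in cube m, (1:ℝ) * wplus f y := fun σ =>
    setIntegral_mono_on (int_wplus hf (ind_meas σ) (ind_mem σ)) hp (cube_meas m) fun y hy =>
      mul_le_mul_of_nonneg_right (ind_mem σ y).2 (wplus_nonneg hf hy)
  have hB : ∀ σ, Bc f m σ ≤ ∫ y in cube m, (1:ℝ) * wminus f y := fun σ =>
    setIntegral_mono_on (int_wminus hf (ind_meas σ) (ind_mem σ)) hq (cube_meas m) fun y hy =>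
      mul_le_mul_of_nonneg_right (ind_mem σ y).2 (wminus_nonneg hf hy)
  exact ⟨max (∫ y in cube m, (1:ℝ) * wplus f y) (∫ y in cube m, (1:ℝ) * wminus f y),
    ((Ac_nonneg hf 0).trans (hA 0)).trans (le_max_left _ _), fun σ =>
    ⟨(hA σ).trans (le_max_left _ _), (hB σ).trans (le_max_right _ _)⟩⟩

/-- tangent lines -/
def G (f : ℝ → ℝ) (m : ℕ) (σ s : ℝ) : ℝ := s * Ac f m σ - (1 - s) * Bc f m σ

/-- optimal utility -/
def Ut (f : ℝ → ℝ) (m : ℕ) (τ s : ℝ) : ℝ := max 0 (G f m (min τ ((1 - s) / s)) s)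

lemma G_upper (hf : Density f f' L R) {z : (Fin m → ℝ) → ℝ} (hz : Measurable z)
    (hz1 : ∀ y, z y ∈ Icc (0:ℝ) 1) {s : ℝ} (hs : 0 < s) :
    s * (∫ y in cube m, z y * wplus f y) - (1 - s) * (∫ y in cube m, z y * wminus f y) ≤
      G f m ((1 - s) / s) s := by
  refine cmpU hf hz hz1 (ind_meas _) (ind_mem _) s ?_
  intro y hy
  have hiff : (1 - s) / s * ∏ k, (1 - y k) ≤ ∏ k, y k ↔
      (1 - s) * ∏ k, (1 - y k) ≤ s * ∏ k, y k := by
    rw [div_mul_eq_mul_div, div_le_iff₀ hs, mul_comm s]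
  unfold ind
  rw [if_congr hiff rfl rfl]
  split_ifs with h
  · exact mul_le_mul_of_nonneg_right (hz1 y).2 (by linarith)
  · push Not at h
    rw [zero_mul]
    exact mul_nonpos_of_nonneg_of_nonpos (hz1 y).1 (by linarith)

lemma G_le_Ut (hf : Density f f' L R) {σ τ s : ℝ} (hστ : σ ≤ τ) (hs0 : 0 ≤ s) :
    G f m σ s ≤ Ut f m τ s := by
  rcases hs0.eq_or_lt with rfl | hs
  · refine le_trans ?_ (le_max_left _ _)
    have := Bc_nonneg (m := m) hf σ
    simp only [G]; linarith
  rcases le_total ((1 - s) / s) τ with h | h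
  · rw [Ut, min_eq_right h]
    exact (G_upper hf (ind_meas σ) (ind_mem σ) hs).trans (le_max_right _ _)
  · rw [Ut, min_eq_left h]
    refine le_trans ?_ (le_max_right _ _)
    refine cmpU hf (ind_meas _) (ind_mem _) (ind_meas _) (ind_mem _) s ?_
    intro y hy
    have hQ := (Q_mem hy).1
    have h' : τ * s ≤ 1 - s := (le_div_iff₀ hs).1 h
    unfold ind
    split_ifs with h1 h2 h2
    · exact le_rfl
    · push Not at h2
      nlinarith
    · exfalso
      nlinarith
    · exact le_rfl

lemma half_int (hf : Density f f' L R) (hL : 0 ≤ L) (hLR : L < R) (hR : R ≤ 1) (g : ℝ → ℝ) :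
    ∫ s in Icc (0:ℝ) 1, g s * f s = ∫ s in L..R, g s * f s := by
  rw [intervalIntegral.integral_of_le hLR.le, ← integral_Icc_eq_integral_Ioc]
  refine setIntegral_eq_of_subset_of_forall_sdiff_eq_zero measurableSet_Icc
    (Icc_subset_Icc hL hR) ?_
  intro s hs
  rw [hf.zero_outside s hs.2, mul_zero]

lemma cube_prod_int (g : ℝ → ℝ) :
    ∫ y in cube m, ∏ k, g (y k) = (∫ s in Icc (0:ℝ) 1, g s) ^ m := by
  have : (volume : Measure (Fin m → ℝ)).restrict (cube m) =
      Measure.pi fun _ => (volume : Measure ℝ).restrict (Icc 0 1) := by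
    rw [volume_pi]; exact Measure.restrict_pi_pi _ _
  rw [this, integral_fintype_prod_eq_prod (fun _ => g)]
  simp

lemma G_zero (hf : Density f f' L R) (hL : 0 ≤ L) (hLR : L < R) (hR : R ≤ 1) :
    G f m 0 (1/2) = 0 := by
  have e1 : ∀ y ∈ cube m, ind 0 y = 1 := fun y hy => by simp [ind, (P_mem hy).1]
  have hA : Ac f m 0 = (1/2)^m := by
    unfold Ac
    rw [setIntegral_congr_fun (g := fun y => ∏ k, (fun s => s * f s) (y k)) (cube_meas m)
      (fun y hy => by simp [e1 y hy, wplus]), cube_prod_int (fun s => s * f s), half_int hf hL hLR hR, hf.mean]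
  have hi : IntervalIntegrable f volume L R := by
    apply ContinuousOn.intervalIntegrable
    rw [uIcc_of_le hLR.le]
    exact fun s hs => (hf.hderiv s hs).continuousWithinAt
  have hi2 : IntervalIntegrable (fun s => s * f s) volume L R :=
    hi.continuousOn_mul continuousOn_id
  have hB : Bc f m 0 = (1/2)^m := by
    unfold Bc
    rw [setIntegral_congr_fun (g := fun y => ∏ k, (fun s => (1 - s) * f s) (y k)) (cube_meas m)
      (fun y hy => by simp [e1 y hy, wminus]), cube_prod_int (fun s => (1 - s) * f s), half_int hf hL hLR hR]
    congr 1
    simp only [sub_mul, one_mul]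
    rw [intervalIntegral.integral_sub hi hi2, hf.total, hf.mean]
    norm_num
  rw [G, hA, hB]; ring

end

/-! ### Integration by parts -/

/-- Weight function. -/
def phi (f f' : ℝ → ℝ) (s : ℝ) : ℝ := 3 * (2 * s - 1) * f s - 2 * s * (1 - s) * f' s

section
variable {f f' : ℝ → ℝ} {L R : ℝ} {m : ℕ}

lemma sub_mono {U X : ℝ → ℝ}
    (hsub : ∀ s ∈ Icc L R, ∀ t ∈ Icc L R, U t + (s - t) * X t ≤ U s) :
    MonotoneOn X (Icc L R) := by
  intro t ht s hs hts
  rcases hts.eq_or_lt with rfl | h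
  · exact le_rfl
  have h1 := hsub s hs t ht
  have h2 := hsub t ht s hs
  by_contra hlt
  push Not at hlt
  nlinarith

lemma sub_cont (hLR : L < R) {U X : ℝ → ℝ}
    (hsub : ∀ s ∈ Icc L R, ∀ t ∈ Icc L R, U t + (s - t) * X t ≤ U s) :
    ContinuousOn U (Icc L R) := by
  have hmono := sub_mono hsub
  have hLm : L ∈ Icc L R := ⟨le_rfl, hLR.le⟩
  have hRm : R ∈ Icc L R := ⟨hLR.le, le_rfl⟩
  have hb : ∀ t ∈ Icc L R, |X t| ≤ max |X L| |X R| := by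
    intro t ht
    exact abs_le_max_abs_abs (hmono hLm ht ht.1) (hmono ht hRm ht.2)
  have hlip : LipschitzOnWith (Real.toNNReal (max |X L| |X R|)) U (Icc L R) := by
    refine LipschitzOnWith.of_dist_le_mul fun s hs t ht => ?_
    rw [Real.coe_toNNReal _ (le_trans (abs_nonneg _) (le_max_left _ _)), Real.dist_eq,
      Real.dist_eq]
    have h1 := hsub s hs t ht
    have h2 := hsub t ht s hs
    have b1 : |(s - t) * X t| ≤ max |X L| |X R| * |s - t| := by
      rw [abs_mul, mul_comm]
      exact mul_le_mul_of_nonneg_right (hb t ht) (abs_nonneg _)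
    have b2 : |(s - t) * X s| ≤ max |X L| |X R| * |s - t| := by
      rw [abs_mul, mul_comm]
      exact mul_le_mul_of_nonneg_right (hb s hs) (abs_nonneg _)
    rw [abs_le] at b1 b2 ⊢
    constructor <;> linarith
  exact hlip.continuousOn

lemma sub_deriv {U X : ℝ → ℝ}
    (hsub : ∀ s ∈ Icc L R, ∀ t ∈ Icc L R, U t + (s - t) * X t ≤ U s)
    {t : ℝ} (ht : t ∈ Ioo L R) (hc : ContinuousWithinAt X (Icc L R) t) :
    HasDerivAt U (X t) t := by
  have hnb : Icc L R ∈ nhds t := Icc_mem_nhds ht.1 ht.2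
  have hc' : ContinuousAt X t := hc.continuousAt hnb
  rw [hasDerivAt_iff_isLittleO, Asymptotics.isLittleO_iff]
  intro c hcpos
  have hX := Metric.continuousAt_iff'.1 hc' c hcpos
  filter_upwards [hX, hnb] with s hs hsI
  have h1 := hsub s hsI t (Ioo_subset_Icc_self ht)
  have h2 := hsub t (Ioo_subset_Icc_self ht) s hsI
  rw [Real.dist_eq] at hs
  have h3 : (s - t) * (X s - X t) ≤ c * |s - t| := by
    calc (s - t) * (X s - X t) ≤ |(s - t) * (X s - X t)| := le_abs_self _
      _ = |X s - X t| * |s - t| := by rw [abs_mul, mul_comm]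
      _ ≤ c * |s - t| := mul_le_mul_of_nonneg_right hs.le (abs_nonneg _)
  rw [Real.norm_eq_abs, Real.norm_eq_abs, abs_le, smul_eq_mul]
  constructor
  · have : 0 ≤ c * |s - t| := by positivity
    linarith
  · linarith

lemma f_cont (hf : Density f f' L R) : ContinuousOn f (Icc L R) :=
  fun s hs => (hf.hderiv s hs).continuousWithinAt

lemma phi_cont (hf : Density f f' L R) : ContinuousOn (phi f f') (Icc L R) := by
  have h1 := f_cont hf
  have h2 := hf.cont_deriv
  unfold phi
  fun_prop

lemma by_parts (hf : Density f f' L R) (hLR : L < R) {U X : ℝ → ℝ}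
    (hsub : ∀ s ∈ Icc L R, ∀ t ∈ Icc L R, U t + (s - t) * X t ≤ U s) :
    ∫ s in L..R, ((2 * s - 1) * U s + 2 * s * (1 - s) * X s) * f s =
      2 * R * (1 - R) * f R * U R - 2 * L * (1 - L) * f L * U L +
        ∫ s in L..R, phi f f' s * U s := by
  have hmono := sub_mono hsub
  have hUc := sub_cont hLR hsub
  have hfc := f_cont hf
  have hf'c := hf.cont_deriv
  have hpc := phi_cont hf
  have hu : uIcc L R = Icc L R := uIcc_of_le hLR.le
  have hXi : IntervalIntegrable X volume L R :=
    MonotoneOn.intervalIntegrable (by rwa [hu])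
  have hi1 : IntervalIntegrable (fun s => phi f f' s * U s) volume L R := by
    apply ContinuousOn.intervalIntegrable
    rw [hu]; exact hpc.mul hUc
  have hi2 : IntervalIntegrable (fun s => ((2 * s - 1) * U s + 2 * s * (1 - s) * X s) * f s)
      volume L R := by
    have a : IntervalIntegrable (fun s => (2 * s - 1) * U s * f s) volume L R := by
      apply ContinuousOn.intervalIntegrable
      rw [hu]; fun_prop
    have b : IntervalIntegrable (fun s => (2 * s * (1 - s) * f s) * X s) volume L R := by
      apply hXi.continuousOn_mul
      rw [hu]; fun_prop
    refine (a.add b).congr ?_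
    intro s _
    ring
  have key := integral_eq_of_hasDerivAt_off_countable
    (fun s => 2 * s * (1 - s) * f s * U s)
    (fun s => ((2 * s - 1) * U s + 2 * s * (1 - s) * X s) * f s - phi f f' s * U s)
    (a := L) (b := R) (s := {t | t ∈ Icc L R ∧ ¬ ContinuousWithinAt X (Icc L R) t})
    hmono.countable_not_continuousWithinAt (by rw [hu]; fun_prop) ?_ (hi2.sub hi1)
  · rw [intervalIntegral.integral_sub hi2 hi1] at key
    linarith
  · intro t ht
    rw [min_eq_left hLR.le, max_eq_right hLR.le] at ht
    have htI : t ∈ Ioo L R := ht.1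
    have hcX : ContinuousWithinAt X (Icc L R) t := by
      by_contra hh
      exact ht.2 ⟨Ioo_subset_Icc_self htI, hh⟩
    have dU := sub_deriv hsub htI hcX
    have df : HasDerivAt f (f' t) t :=
      (hf.hderiv t (Ioo_subset_Icc_self htI)).hasDerivAt (Icc_mem_nhds htI.1 htI.2)
    have dq : HasDerivAt (fun s : ℝ => 2 * s * (1 - s)) (2 * (1 - t) + 2 * t * (-1)) t := by
      have e1 : HasDerivAt (fun s : ℝ => 2 * s) 2 t := by
        simpa using (hasDerivAt_id t).const_mul (2:ℝ)
      have e2 : HasDerivAt (fun s : ℝ => 1 - s) (-1) t := by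
        simpa using (hasDerivAt_id t).const_sub (1:ℝ)
      exact e1.mul e2
    refine ((dq.mul df).mul dU).congr_deriv ?_
    simp only [phi, Pi.mul_apply]
    ring

/-! ### Sign of the weight -/

lemma LR_sum (hf : Density f f' L R) (hLR : L < R) (hsym : ∀ s : ℝ, f s = f (1 - s)) :
    L + R = 1 := by
  have h : ∀ s ∈ Icc L R, 1 - s ∈ Icc L R := by
    intro s hs
    by_contra hh
    have := hf.zero_outside _ hh
    rw [← hsym] at this
    exact (hf.pos s hs).ne' this
  have h1 := h L ⟨le_rfl, hLR.le⟩
  have h2 := h R ⟨hLR.le, le_rfl⟩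
  linarith [h1.2, h2.1]

lemma f_mono (hf : Density f f' L R) (hLR : L < R)
    (hconc : ConcaveOn ℝ (Icc L R) (fun s => Real.log (f s)))
    (hsym : ∀ s : ℝ, f s = f (1 - s)) : MonotoneOn f (Icc L (1/2)) := by
  have hs1 := LR_sum hf hLR hsym
  intro s hs t ht hst
  have hsI : s ∈ Icc L R := ⟨hs.1, by linarith [hs.2]⟩
  have htI : t ∈ Icc L R := ⟨ht.1, by linarith [ht.2]⟩
  have hsI' : 1 - s ∈ Icc L R := ⟨by linarith [hs.2], by linarith [hs.1]⟩
  have := hconc.min_le_of_mem_Icc hsI hsI' (z := t) ⟨hst, by linarith [hs.2, ht.2]⟩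
  simp only [← hsym, min_self] at this
  exact (Real.log_le_log_iff (hf.pos s hsI) (hf.pos t htI)).1 this

lemma f_anti (hf : Density f f' L R) (hLR : L < R)
    (hconc : ConcaveOn ℝ (Icc L R) (fun s => Real.log (f s)))
    (hsym : ∀ s : ℝ, f s = f (1 - s)) : AntitoneOn f (Icc (1/2) R) := by
  have hs1 := LR_sum hf hLR hsym
  intro s hs t ht hst
  rw [hsym s, hsym t]
  exact f_mono hf hLR hconc hsym ⟨by linarith [ht.2], by linarith [ht.1]⟩
    ⟨by linarith [hs.2], by linarith [hs.1]⟩ (by linarith)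

lemma phi_nonpos (hf : Density f f' L R) (hL : 0 ≤ L) (hLR : L < R)
    (hconc : ConcaveOn ℝ (Icc L R) (fun s => Real.log (f s)))
    (hsym : ∀ s : ℝ, f s = f (1 - s)) {s : ℝ} (hs : s ∈ Ioo L (1/2)) : phi f f' s ≤ 0 := by
  have hs1 := LR_sum hf hLR hsym
  have hsR : s < R := by linarith [hs.1, hs.2]
  have df : HasDerivAt f (f' s) s :=
      (hf.hderiv s ⟨hs.1.le, hsR.le⟩).hasDerivAt (Icc_mem_nhds hs.1 hsR)
  have h := (f_mono hf hLR hconc hsym).derivWithin_nonneg (x := s)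
  rw [derivWithin_of_mem_nhds (Icc_mem_nhds hs.1 hs.2), df.deriv] at h
  have h0 := hf.nonneg s
  have h1 : 0 ≤ s * (1 - s) * f' s :=
    mul_nonneg (mul_nonneg (by linarith [hs.1]) (by linarith [hs.2])) h
  unfold phi
  nlinarith [hs.2]

lemma phi_nonneg (hf : Density f f' L R) (hR : R ≤ 1) (hLR : L < R)
    (hconc : ConcaveOn ℝ (Icc L R) (fun s => Real.log (f s)))
    (hsym : ∀ s : ℝ, f s = f (1 - s)) {s : ℝ} (hs : s ∈ Ioo (1/2) R) : 0 ≤ phi f f' s := by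
  have hs1 := LR_sum hf hLR hsym
  have hsL : L < s := by linarith [hs.1, hs.2]
  have df : HasDerivAt f (f' s) s :=
      (hf.hderiv s ⟨hsL.le, hs.2.le⟩).hasDerivAt (Icc_mem_nhds hsL hs.2)
  have h := (f_anti hf hLR hconc hsym).derivWithin_nonpos (x := s)
  rw [derivWithin_of_mem_nhds (Icc_mem_nhds hs.1 hs.2), df.deriv] at h
  have h0 := hf.nonneg s
  have h1 : s * (1 - s) * f' s ≤ 0 :=
    mul_nonpos_of_nonneg_of_nonpos
      (mul_nonneg (by linarith [hs.1]) (by linarith [hs.2])) h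
  unfold phi
  nlinarith [hs.1]

end

/-! ### The optimal mechanism -/

section
variable {f f' : ℝ → ℝ} {L R : ℝ} {m : ℕ}

def smn (f : ℝ → ℝ) (m : ℕ) (τ : ℝ) : ℝ := Bc f m τ / (Ac f m τ + Bc f m τ)

lemma smn_eq (hf : Density f f' L R) (τ : ℝ) :
    smn f m τ * (Ac f m τ + Bc f m τ) = Bc f m τ := by
  have hA := Ac_nonneg (m := m) hf τ
  have hB := Bc_nonneg (m := m) hf τ
  by_cases h : Ac f m τ + Bc f m τ = 0
  · have : Bc f m τ = 0 := by linarith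
    rw [h, this, mul_zero]
  · exact div_mul_cancel₀ _ h

lemma smn_nonneg (hf : Density f f' L R) (τ : ℝ) : 0 ≤ smn f m τ :=
  div_nonneg (Bc_nonneg hf τ) (add_nonneg (Ac_nonneg hf τ) (Bc_nonneg hf τ))

lemma G_nonneg (hf : Density f f' L R) {s : ℝ} (hs : 0 < s) : 0 ≤ G f m ((1 - s) / s) s := by
  have := G_upper (m := m) hf (z := fun _ => 0) measurable_const (fun y => by simp) hs
  simpa using this

lemma smax_inv {τ : ℝ} (hτ : 0 ≤ τ) : (1 - 1 / (1 + τ)) / (1 / (1 + τ)) = τ := by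
  have : (1 + τ) ≠ 0 := by positivity
  field_simp
  ring

lemma smn_le (hf : Density f f' L R) {τ : ℝ} (hτ : 0 ≤ τ) : smn f m τ ≤ 1 / (1 + τ) := by
  have hA := Ac_nonneg (m := m) hf τ
  have hB := Bc_nonneg (m := m) hf τ
  have hp : 0 < 1 / (1 + τ) := by positivity
  have h := G_nonneg (m := m) hf hp
  rw [smax_inv hτ] at h
  rcases (add_nonneg hA hB).eq_or_lt with h0 | h0
  · rw [smn, ← h0, div_zero]; exact hp.le
  · rw [smn, div_le_iff₀ h0]
    unfold G at h
    linarith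

def xst (f : ℝ → ℝ) (m : ℕ) (τ : ℝ) (s : ℝ) (y : Fin m → ℝ) : ℝ :=
  if s < smn f m τ then 0
  else if s < 1 / (1 + τ) then (if τ * ∏ k, (1 - y k) ≤ ∏ k, y k then 1 else 0)
  else (if (1 - s) * ∏ k, (1 - y k) ≤ s * ∏ k, y k then 1 else 0)

lemma xst_mech (τ : ℝ) : IsMechanism (xst f m τ) := by
  constructor
  · unfold Function.uncurry xst
    refine Measurable.ite (measurableSet_lt (by fun_prop) (by fun_prop)) measurable_const ?_
    refine Measurable.ite (measurableSet_lt (by fun_prop) (by fun_prop)) ?_ ?_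
    · exact Measurable.ite (measurableSet_le (by fun_prop) (by fun_prop))
        measurable_const measurable_const
    · exact Measurable.ite (measurableSet_le (by fun_prop) (by fun_prop))
        measurable_const measurable_const
  · intro s y
    unfold xst
    split_ifs <;> simp

lemma xst_low {τ t : ℝ} (h : t < smn f m τ) :
    Amap f (xst f m τ) t = 0 ∧ Bmap f (xst f m τ) t = 0 := by
  have : ∀ y, xst f m τ t y = 0 := fun y => by simp [xst, h]
  simp [Amap, Bmap, this]

lemma xst_mid {τ t : ℝ} (h : ¬ t < smn f m τ) (h2 : t < 1 / (1 + τ)) :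
    Amap f (xst f m τ) t = Ac f m τ ∧ Bmap f (xst f m τ) t = Bc f m τ := by
  have : ∀ y, xst f m τ t y = ind τ y := fun y => by rw [xst, if_neg h, if_pos h2, ind]
  simp [Amap, Bmap, Ac, Bc, this]

lemma xst_high {τ t : ℝ} (h : ¬ t < smn f m τ) (h2 : ¬ t < 1 / (1 + τ)) (ht : 0 < t) :
    Amap f (xst f m τ) t = Ac f m ((1 - t) / t) ∧
      Bmap f (xst f m τ) t = Bc f m ((1 - t) / t) := by
  have : ∀ y, xst f m τ t y = ind ((1 - t) / t) y := fun y => by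
    have hiff : (1 - t) / t * ∏ k, (1 - y k) ≤ ∏ k, y k ↔
      (1 - t) * ∏ k, (1 - y k) ≤ t * ∏ k, y k := by
      rw [div_mul_eq_mul_div, div_le_iff₀ ht, mul_comm t]
    rw [xst, if_neg h, if_neg h2, ind, if_congr hiff rfl rfl]
  simp [Amap, Bmap, Ac, Bc, this]

/-- normalized utility -/
def Un (f : ℝ → ℝ) (x : ℝ → (Fin m → ℝ) → ℝ) (s : ℝ) : ℝ :=
  s * Amap f x s - (1 - s) * Bmap f x s

lemma high_le {τ t : ℝ} (hτ : 0 ≤ τ) (h2 : ¬ t < 1 / (1 + τ)) : 0 < t ∧ (1 - t) / t ≤ τ := by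
  push Not at h2
  have hp : 0 < 1 / (1 + τ) := by positivity
  have ht : 0 < t := lt_of_lt_of_le hp h2
  refine ⟨ht, ?_⟩
  rw [div_le_iff₀ (by positivity)] at h2
  rw [div_le_iff₀ ht]
  linarith

lemma low_le {τ t : ℝ} (hτ : 0 ≤ τ) (ht : 0 < t) (h2 : t ≤ 1 / (1 + τ)) : τ ≤ (1 - t) / t := by
  rw [le_div_iff₀ (by positivity)] at h2
  rw [le_div_iff₀ ht]
  linarith

lemma xst_line (hf : Density f f' L R) {τ : ℝ} (hτ : 0 ≤ τ) (t : ℝ) {s : ℝ} (hs : 0 ≤ s) :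
    s * Amap f (xst f m τ) t - (1 - s) * Bmap f (xst f m τ) t ≤ Ut f m τ s := by
  by_cases h1 : t < smn f m τ
  · rw [(xst_low h1).1, (xst_low h1).2]
    simp [Ut]
  by_cases h2 : t < 1 / (1 + τ)
  · rw [(xst_mid h1 h2).1, (xst_mid h1 h2).2]
    exact G_le_Ut hf le_rfl hs
  · obtain ⟨ht, hle⟩ := high_le hτ h2
    rw [(xst_high h1 h2 ht).1, (xst_high h1 h2 ht).2]
    exact G_le_Ut hf hle hs

lemma Ut_zero (hf : Density f f' L R) (τ : ℝ) : Ut f m τ 0 = 0 := by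
  unfold Ut G
  rw [max_eq_left]
  have := Bc_nonneg (m := m) hf (min τ ((1 - 0) / 0))
  linarith

lemma xst_Un (hf : Density f f' L R) {τ : ℝ} (hτ : 0 ≤ τ) {t : ℝ} (ht0 : 0 ≤ t) :
    Un f (xst f m τ) t = Ut f m τ t := by
  apply le_antisymm (xst_line hf hτ t ht0)
  have hA := Ac_nonneg (m := m) hf τ
  have hB := Bc_nonneg (m := m) hf τ
  have he := smn_eq (m := m) hf τ
  have hn := smn_nonneg (m := m) hf τ
  by_cases h1 : t < smn f m τ
  · rw [(xst_low h1).1, (xst_low h1).2]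
    rcases ht0.eq_or_lt with rfl | ht
    · rw [Ut_zero hf]; simp
    rw [Ut, min_eq_left (low_le hτ ht (h1.le.trans (smn_le hf hτ)))]
    refine max_le (by simp) ?_
    unfold G
    nlinarith
  by_cases h2 : t < 1 / (1 + τ)
  · rw [(xst_mid h1 h2).1, (xst_mid h1 h2).2]
    have h0 : 0 ≤ t * Ac f m τ - (1 - t) * Bc f m τ := by
      push Not at h1
      nlinarith
    rcases ht0.eq_or_lt with rfl | ht
    · rw [Ut_zero hf]; exact h0
    rw [Ut, min_eq_left (low_le hτ ht h2.le)]
    exact max_le h0 le_rfl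
  · obtain ⟨ht, hle⟩ := high_le hτ h2
    rw [(xst_high h1 h2 ht).1, (xst_high h1 h2 ht).2, Ut, min_eq_right hle]
    exact max_le (G_nonneg hf ht) le_rfl

lemma xst_feas (hf : Density f f' L R) (hL : 0 ≤ L) {τ : ℝ} (hτ : 0 ≤ τ) :
    Feasible f L R (xst f m τ) := by
  have h2 : (0:ℝ) < 2 ^ m := by positivity
  refine ⟨xst_mech τ, fun s hs => ?_, fun s hs t ht => ?_⟩
  · have := xst_Un (m := m) hf hτ (hL.trans hs.1)
    unfold Un at this
    rw [Upay, this]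
    exact mul_nonneg h2.le (le_max_left _ _)
  · have := xst_Un (m := m) hf hτ (hL.trans hs.1)
    unfold Un at this
    unfold Upay
    rw [this]
    exact mul_le_mul_of_nonneg_left (xst_line hf hτ t (hL.trans hs.1)) h2.le

lemma feas_line {x : ℝ → (Fin m → ℝ) → ℝ} (hx : Feasible f L R x)
    {s t : ℝ} (hs : s ∈ Icc L R) (ht : t ∈ Icc L R) :
    s * Amap f x t - (1 - s) * Bmap f x t ≤ Un f x s := by
  have h2 : (0:ℝ) < 2 ^ m := by positivity
  exact le_of_mul_le_mul_left (hx.2.2 s hs t ht) h2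

lemma feas_nonneg {x : ℝ → (Fin m → ℝ) → ℝ} (hx : Feasible f L R x)
    {s : ℝ} (hs : s ∈ Icc L R) : 0 ≤ Un f x s := by
  have h2 : (0:ℝ) < 2 ^ m := by positivity
  exact nonneg_of_mul_nonneg_right (hx.2.1 s hs) h2

lemma feas_sub {x : ℝ → (Fin m → ℝ) → ℝ} (hx : Feasible f L R x) :
    ∀ s ∈ Icc L R, ∀ t ∈ Icc L R,
      Un f x t + (s - t) * (Amap f x t + Bmap f x t) ≤ Un f x s := by
  intro s hs t ht
  have := feas_line hx hs ht
  have e : Un f x t = t * Amap f x t - (1 - t) * Bmap f x t := rfl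
  rw [e]
  linarith

def Wf (f f' : ℝ → ℝ) (L R : ℝ) (U : ℝ → ℝ) : ℝ :=
  2 * R * (1 - R) * f R * U R - 2 * L * (1 - L) * f L * U L + ∫ s in L..R, phi f f' s * U s

lemma Value_eq (hf : Density f f' L R) (hLR : L < R) {x : ℝ → (Fin m → ℝ) → ℝ}
    (hx : Feasible f L R x) : Value f L R x = 2 ^ m * Wf f f' L R (Un f x) := by
  unfold Value Wf
  rw [← by_parts hf hLR (feas_sub hx)]
  congr 2
  ext s
  unfold Un
  ring

lemma feas_cont (hLR : L < R) {x : ℝ → (Fin m → ℝ) → ℝ}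
    (hx : Feasible f L R x) : ContinuousOn (Un f x) (Icc L R) :=
  sub_cont hLR (feas_sub hx)

lemma G_cont (hf : Density f f' L R) (hm : 1 ≤ m) (s : ℝ) : Continuous fun σ => G f m σ s := by
  have h1 := Ac_cont hf hm
  have h2 := Bc_cont hf hm
  unfold G
  fun_prop

lemma Ut_cont (hf : Density f f' L R) (hm : 1 ≤ m) (s : ℝ) : Continuous fun τ => Ut f m τ s := by
  unfold Ut
  exact continuous_const.max ((G_cont hf hm s).comp (continuous_id.min continuous_const))

lemma Ut_meas (hf : Density f f' L R) (hm : 1 ≤ m) (τ : ℝ) : Measurable (Ut f m τ) := by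
  have h1 := (Ac_cont hf hm).measurable
  have h2 := (Bc_cont hf hm).measurable
  unfold Ut G
  fun_prop

lemma Ut_bdd (hf : Density f f' L R) (m : ℕ) : ∃ C, 0 ≤ C ∧ ∀ τ, ∀ s ∈ Icc (0:ℝ) 1,
    Ut f m τ s ≤ C := by
  obtain ⟨C, hC0, hC⟩ := Ac_bdd hf m
  refine ⟨C, hC0, fun τ s hs => max_le hC0 ?_⟩
  unfold G
  have h1 := (hC (min τ ((1 - s) / s))).1
  have h2 := Bc_nonneg (m := m) hf (min τ ((1 - s) / s))
  have h3 := Ac_nonneg (m := m) hf (min τ ((1 - s) / s))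
  have h4 := mul_nonneg (sub_nonneg.2 hs.2) h2
  have h5 := mul_nonneg (sub_nonneg.2 hs.2) h3
  linarith

lemma W_cont (hf : Density f f' L R) (hL : 0 ≤ L) (hLR : L < R) (hR : R ≤ 1) (hm : 1 ≤ m) :
    Continuous fun τ => Wf f f' L R (Ut f m τ) := by
  obtain ⟨C, hC0, hC⟩ := Ut_bdd hf m
  have hpc := phi_cont hf
  have hpi : IntervalIntegrable (phi f f') volume L R := by
    apply ContinuousOn.intervalIntegrable
    rwa [uIcc_of_le hLR.le]
  have hint : Continuous fun τ => ∫ s in L..R, phi f f' s * Ut f m τ s := by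
    refine intervalIntegral.continuous_of_dominated_interval
      (bound := fun s => |phi f f' s| * C) ?_ ?_ (hpi.abs.mul_const C) ?_
    · intro τ
      exact (hpi.def'.aestronglyMeasurable).mul (Ut_meas hf hm τ).aestronglyMeasurable
    · intro τ
      refine Eventually.of_forall fun s hs => ?_
      rw [uIoc_of_le hLR.le] at hs
      rw [norm_mul, Real.norm_eq_abs, Real.norm_of_nonneg (show 0 ≤ Ut f m τ s from le_max_left _ _)]
      exact mul_le_mul_of_nonneg_left
        (hC τ s ⟨hL.trans hs.1.le, hs.2.trans hR⟩) (abs_nonneg _)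
    · refine Eventually.of_forall fun s hs => ?_
      exact continuous_const.mul (Ut_cont hf hm s)
  unfold Wf
  have h1 := Ut_cont hf hm R
  have h2 := Ut_cont hf hm L
  exact ((continuous_const.mul h1).sub (continuous_const.mul h2)).add hint

/-! ### Comparison -/

lemma lin_between {α β p q s : ℝ} (hp : 0 ≤ p * α - (1 - p) * β) (hq : 0 ≤ q * α - (1 - q) * β)
    (h1 : p ≤ s) (h2 : s ≤ q) : 0 ≤ s * α - (1 - s) * β := by
  rcases le_total 0 (α + β) with h | h <;> nlinarith

lemma compare (hf : Density f f' L R) (hL : 0 ≤ L) (hLR : L < R) (hR : R ≤ 1) (hm : 1 ≤ m)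
    (hsym : ∀ s : ℝ, f s = f (1 - s)) {x : ℝ → (Fin m → ℝ) → ℝ} (hx : Feasible f L R x) :
    ∃ τ ∈ Icc (0:ℝ) 1, (∀ s ∈ Icc L R, s ≤ 1/2 → Ut f m τ s ≤ Un f x s) ∧
      (∀ s ∈ Icc L R, 1/2 ≤ s → Un f x s ≤ Ut f m τ s) := by
  have hs1 := LR_sum hf hLR hsym
  have hh : (1/2 : ℝ) ∈ Icc L R := ⟨by linarith, by linarith⟩
  have hup : ∀ t s : ℝ, 0 < s →
      s * Amap f x t - (1 - s) * Bmap f x t ≤ G f m ((1 - s) / s) s := fun t s hs =>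
    G_upper hf (hx.1.1.comp measurable_prodMk_left) (fun y => hx.1.2 t y) hs
  have e1 : (1 - (1/2:ℝ)) / (1/2) = 1 := by norm_num
  have hu0 := feas_nonneg hx hh
  have hu1 : Un f x (1/2) ≤ G f m 1 (1/2) := by
    have := hup (1/2) (1/2) (by norm_num)
    rwa [e1] at this
  obtain ⟨τ, hτ, hτu⟩ := intermediate_value_Icc (zero_le_one' ℝ)
    (G_cont hf hm (1/2)).continuousOn ⟨by rw [G_zero hf hL hLR hR]; exact hu0, hu1⟩
  simp only at hτu
  have hslope : ∀ σ, 0 ≤ σ → σ < 1 → G f m σ (1/2) ≤ Un f x (1/2) →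
      Amap f x (1/2) + Bmap f x (1/2) ≤ Ac f m σ + Bc f m σ := by
    intro σ h0 h1 hle
    have hp : 1/2 < 1 / (1 + σ) := by
      apply one_div_lt_one_div_of_lt <;> linarith
    have := hup (1/2) (1 / (1 + σ)) (by positivity)
    rw [smax_inv h0] at this
    generalize 1 / (1 + σ) = p at hp this
    unfold G Un at *
    by_contra hcon
    push Not at hcon
    nlinarith
  have hsl : Amap f x (1/2) + Bmap f x (1/2) ≤ Ac f m τ + Bc f m τ := by
    rcases hτ.2.eq_or_lt with rfl | hlt
    · have hc : Tendsto (fun σ => Ac f m σ + Bc f m σ) (nhdsWithin 1 (Iio 1))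
          (nhds (Ac f m 1 + Bc f m 1)) :=
        (((Ac_cont hf hm).add (Bc_cont hf hm)).tendsto 1).mono_left nhdsWithin_le_nhds
      refine ge_of_tendsto hc ?_
      filter_upwards [Ioo_mem_nhdsLT (zero_lt_one' ℝ)] with σ hσ
      refine hslope σ hσ.1.le hσ.2 ?_
      rw [← hτu]
      have := G_upper (m := m) hf (ind_meas σ) (ind_mem σ) (s := 1/2) (by norm_num)
      rwa [e1] at this
    · exact hslope τ hτ.1 hlt hτu.le
  have hple : 1/2 ≤ 1 / (1 + τ) := by
    apply one_div_le_one_div_of_le <;> linarith [hτ.1, hτ.2]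
  refine ⟨τ, hτ, fun s hs hs2 => ?_, fun s hs hs2 => ?_⟩
  · rcases (hL.trans hs.1).eq_or_lt with h0 | h0
    · have h3 := feas_nonneg hx hs
      rw [← h0] at h3 ⊢
      rwa [Ut_zero hf]
    rw [Ut, min_eq_left (low_le hτ.1 h0 (hs2.trans hple))]
    refine max_le (feas_nonneg hx hs) (le_trans ?_ (feas_line hx hs hh))
    unfold G Un at *
    nlinarith
  · have h0 : 0 < s := by linarith
    by_cases h2 : s < 1 / (1 + τ)
    · rw [Ut, min_eq_left (low_le hτ.1 h0 h2.le)]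
      refine le_trans ?_ (le_max_right _ _)
      have a1 := feas_line hx hh hs
      have a2 := hup s (1 / (1 + τ)) (by linarith)
      rw [smax_inv hτ.1] at a2
      rw [← hτu] at a1
      have := lin_between (α := Ac f m τ - Amap f x s) (β := Bc f m τ - Bmap f x s)
        (p := 1/2) (q := 1 / (1 + τ)) (s := s) (by unfold G at a1; linarith)
        (by unfold G at a2; linarith) hs2 h2.le
      unfold G Un
      linarith
    · rw [Ut, min_eq_right (high_le hτ.1 h2).2]
      exact (hup s s h0).trans (le_max_right _ _)

lemma W_le (hf : Density f f' L R) (hL : 0 ≤ L) (hLR : L < R) (hR : R ≤ 1)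
    (hconc : ConcaveOn ℝ (Icc L R) (fun s => Real.log (f s)))
    (hsym : ∀ s : ℝ, f s = f (1 - s)) {U V : ℝ → ℝ}
    (hU : ContinuousOn U (Icc L R)) (hV : ContinuousOn V (Icc L R))
    (h1 : ∀ s ∈ Icc L R, s ≤ 1/2 → V s ≤ U s)
    (h2 : ∀ s ∈ Icc L R, 1/2 ≤ s → U s ≤ V s) : Wf f f' L R U ≤ Wf f f' L R V := by
  have hs1 := LR_sum hf hLR hsym
  have hpc := phi_cont hf
  have hRI : R ∈ Icc L R := ⟨hLR.le, le_rfl⟩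
  have hLI : L ∈ Icc L R := ⟨le_rfl, hLR.le⟩
  unfold Wf
  have a : 2 * R * (1 - R) * f R * U R ≤ 2 * R * (1 - R) * f R * V R := by
    apply mul_le_mul_of_nonneg_left (h2 R hRI (by linarith))
    exact mul_nonneg (mul_nonneg (by linarith) (by linarith)) (hf.nonneg R)
  have b : 2 * L * (1 - L) * f L * V L ≤ 2 * L * (1 - L) * f L * U L := by
    apply mul_le_mul_of_nonneg_left (h1 L hLI (by linarith))
    exact mul_nonneg (mul_nonneg (by linarith) (by linarith)) (hf.nonneg L)
  have c : ∫ s in L..R, phi f f' s * U s ≤ ∫ s in L..R, phi f f' s * V s := by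
    refine intervalIntegral.integral_mono_on_of_le_Ioo hLR.le ?_ ?_ ?_
    · apply ContinuousOn.intervalIntegrable
      rw [uIcc_of_le hLR.le]; exact hpc.mul hU
    · apply ContinuousOn.intervalIntegrable
      rw [uIcc_of_le hLR.le]; exact hpc.mul hV
    · intro s hs
      have hsI := Ioo_subset_Icc_self hs
      rcases lt_trichotomy s (1/2) with h | h | h
      · exact mul_le_mul_of_nonpos_left (h1 s hsI h.le)
          (phi_nonpos hf hL hLR hconc hsym ⟨hs.1, h⟩)
      · rw [le_antisymm (h2 s hsI h.ge) (h1 s hsI h.le)]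
      · exact mul_le_mul_of_nonneg_left (h2 s hsI h.le)
          (phi_nonneg hf hR hLR hconc hsym ⟨h, hs.2⟩)
  linarith

lemma Wf_congr (hLR : L < R) {U V : ℝ → ℝ} (h : ∀ s ∈ Icc L R, U s = V s) :
    Wf f f' L R U = Wf f f' L R V := by
  unfold Wf
  rw [h R ⟨hLR.le, le_rfl⟩, h L ⟨le_rfl, hLR.le⟩]
  congr 1
  apply intervalIntegral.integral_congr
  intro s hs
  rw [uIcc_of_le hLR.le] at hs
  simp only [h s hs]

end

theorem stmt1 (n : ℕ) (hn : 2 ≤ n) (L R : ℝ) (hL : 0 ≤ L) (hLR : L < R) (hR : R ≤ 1)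
    (f f' : ℝ → ℝ) (hf : Density f f' L R)
    (hconc : ConcaveOn ℝ (Set.Icc L R) (fun s => Real.log (f s)))
    (hsym : ∀ s : ℝ, f s = f (1 - s)) :
    ∃ τ smin smax : ℝ, ∃ xstar : ℝ → (Fin (n - 1) → ℝ) → ℝ,
      0 ≤ τ ∧ 0 ≤ smin ∧ smin ≤ smax ∧ smax ≤ 1 ∧
      smax = 1 / (1 + τ) ∧
      smin * ((∫ y in cube (n - 1),
            (if τ * ∏ k, (1 - y k) ≤ ∏ k, y k then wplus f y else 0)) +
          (∫ y in cube (n - 1),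
            (if τ * ∏ k, (1 - y k) ≤ ∏ k, y k then wminus f y else 0))) =
        (∫ y in cube (n - 1),
          (if τ * ∏ k, (1 - y k) ≤ ∏ k, y k then wminus f y else 0)) ∧
      (∀ (s : ℝ) (y : Fin (n - 1) → ℝ),
        xstar s y =
          if s < smin then 0
          else if s < smax then (if τ * ∏ k, (1 - y k) ≤ ∏ k, y k then 1 else 0)
          else (if (1 - s) * ∏ k, (1 - y k) ≤ s * ∏ k, y k then 1 else 0)) ∧
      Feasible f L R xstar ∧
      (∀ x : ℝ → (Fin (n - 1) → ℝ) → ℝ, Feasible f L R x →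
        Value f L R x ≤ Value f L R xstar) := by
  have hm : 1 ≤ n - 1 := by omega
  obtain ⟨τ, hτ, hmax⟩ := isCompact_Icc.exists_isMaxOn (nonempty_Icc.2 (zero_le_one' ℝ))
    (W_cont (m := n - 1) hf hL hLR hR hm).continuousOn
  have hA : (∫ y in cube (n - 1),
      (if τ * ∏ k, (1 - y k) ≤ ∏ k, y k then wplus f y else 0)) = Ac f (n - 1) τ := by
    unfold Ac ind
    simp only [ite_mul, one_mul, zero_mul]
  have hB : (∫ y in cube (n - 1),
      (if τ * ∏ k, (1 - y k) ≤ ∏ k, y k then wminus f y else 0)) = Bc f (n - 1) τ := by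
    unfold Bc ind
    simp only [ite_mul, one_mul, zero_mul]
  refine ⟨τ, smn f (n - 1) τ, 1 / (1 + τ), xst f (n - 1) τ, hτ.1, smn_nonneg hf τ,
    smn_le hf hτ.1, ?_, rfl, ?_, fun s y => rfl, xst_feas hf hL hτ.1, ?_⟩
  · rw [div_le_one (by linarith [hτ.1])]
    linarith [hτ.1]
  · rw [hA, hB]
    exact smn_eq hf τ
  · intro x hx
    have hW : ∀ t : ℝ, 0 ≤ t → ∀ s ∈ Icc L R,
        Un f (xst f (n - 1) t) s = Ut f (n - 1) t s := fun t ht s hs =>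
      xst_Un hf ht (hL.trans hs.1)
    obtain ⟨t, ht, c1, c2⟩ := compare hf hL hLR hR hm hsym hx
    rw [Value_eq hf hLR hx, Value_eq hf hLR (xst_feas hf hL hτ.1)]
    apply mul_le_mul_of_nonneg_left _ (by positivity)
    rw [Wf_congr hLR (hW τ hτ.1)]
    refine le_trans ?_ (hmax ht)
    refine W_le hf hL hLR hR hconc hsym (feas_cont hLR hx) ?_ c1 c2
    exact (feas_cont hLR (xst_feas hf hL ht.1)).congr fun s hs => (hW t ht.1 s hs).symm
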